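/- arXiv:0908.1511 — 4 statements merged into one kernel-verified Lean document; each statement's English description precedes it below -/
import Mathlib

section
/- Let w ∈ ℂ and let g : ℂ → ℂ be complex-analytic at w with deriv g w ≠ 0. Then there exist a, b, c, d ∈ ℂ with a·d − b·c = 1 and c·g(w) + d ≠ 0 such that, as z → w, (a·g(z) + b)/(c·g(z) + d) = z + (S/6)·(z − w)^3 + O((z − w)^4), where S = {g,w} is the Schwarzian derivative of g at w. (Existence part of Lemma 3.1 of the paper, finite case: every locally conformal map can be normalized by a Möbius transformation so that its deviation from the identity starts at third order, with third-order coefficient given by the Schwarzian derivative.) -/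
open Complex Filter Topology

/-- The Schwarzian derivative of `g` at `w`:
`{g,w} = g'''(w)/g'(w) - (3/2)(g''(w)/g'(w))^2`. -/
noncomputable def schwarzian (g : ℂ → ℂ) (w : ℂ) : ℂ :=
  iteratedDeriv 3 g w / deriv g w - (3 / 2) * (iteratedDeriv 2 g w / deriv g w) ^ 2

/-- `f z = φ z + O((z - w)^4)` as `z → w`: there exist `C > 0` and a neighbourhood of `w`
on which `‖f z - φ z‖ ≤ C * ‖z - w‖^4`. -/
def IsBigO4At (w : ℂ) (f φ : ℂ → ℂ) : Prop :=
  ∃ C > (0 : ℝ), ∀ᶠ z in 𝓝 w, ‖f z - φ z‖ ≤ C * ‖z - w‖ ^ 4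

/-- The third-order Taylor formula at a point of analyticity. -/
theorem AnalyticAt.isBigO_sub_taylor_three {g : ℂ → ℂ} {w : ℂ} (hg : AnalyticAt ℂ g w) :
    (fun h => g (w + h) - g w - (deriv g w * h + iteratedDeriv 2 g w / 2 * h ^ 2 +
      iteratedDeriv 3 g w / 6 * h ^ 3)) =O[𝓝 0] fun h => h ^ 4 := by
  refine ((hg.hasFPowerSeriesAt.isBigO_sub_partialSum_pow 4).congr_left fun h => ?_).trans ?_
  · simp [FormalMultilinearSeries.partialSum, Finset.sum_range_succ, Nat.factorial]
    ring
  · exact Asymptotics.isBigO_of_le _ fun h => by simp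

/-- Existence part of Lemma 3.1 (finite case): every map conformal at `w` can be normalized
by a Möbius transformation so that its deviation from the identity starts at third order,
with third-order coefficient the Schwarzian derivative `{g,w}`. -/
theorem mobius_normalization_exists (w : ℂ) (g : ℂ → ℂ)
    (hg : AnalyticAt ℂ g w) (hg' : deriv g w ≠ 0) :
    ∃ a b c d : ℂ, a * d - b * c = 1 ∧ c * g w + d ≠ 0 ∧
      IsBigO4At w (fun z => (a * g z + b) / (c * g z + d))
        (fun z => z + (schwarzian g w / 6) * (z - w) ^ 3) := by
  obtain ⟨s, hs'⟩ := IsAlgClosed.exists_pow_nat_eq (deriv g w) two_pos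
  have hs := hs'.symm
  have hs0 : s ≠ 0 := by rintro rfl; simp [hs] at hg'
  set p := deriv g w with hp
  set A := iteratedDeriv 2 g w / (2 * p) with hA
  set S := schwarzian g w with hS
  refine ⟨(w * A + 1) / s, (w * p - (w * A + 1) * g w) / s, A / s, (p - A * g w) / s, ?_, ?_, ?_⟩
  · rw [hs]; field_simp; ring
  · rw [show A / s * g w + (p - A * g w) / s = s by rw [hs]; field_simp; ring]
    exact hs0
  have hden : Tendsto (fun z => p + A * (g z - g w)) (𝓝 w) (𝓝 p) := by
    have : ContinuousAt (fun z => p + A * (g z - g w)) w := by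
      have := hg.continuousAt
      fun_prop
    simpa [ContinuousAt] using this
  have hR := hg.isBigO_sub_taylor_three.comp_tendsto
    (show Tendsto (fun z => z - w) (𝓝 w) (𝓝 0) by
      simpa using (continuous_sub_right w).tendsto w)
  set B := iteratedDeriv 3 g w / 6 with hB
  have hSB : S / 6 = B / p - A ^ 2 := by
    simp only [hS, schwarzian, hA, hB, ← hp]; field_simp; ring
  have hone {f : ℂ → ℂ} (hf : ContinuousAt f w) : f =O[𝓝 w] fun _ => (1 : ℂ) :=
    hf.tendsto.isBigO_one ℂ
  have hnum : (fun z => (g z - g w) - ((z - w) + S / 6 * (z - w) ^ 3) *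
      (p + A * (g z - g w))) =O[𝓝 w] fun z => (z - w) ^ 4 := by
    have h1 := hR.mul (hone (f := fun z => 1 - A * ((z - w) + S / 6 * (z - w) ^ 3))
      (by fun_prop))
    have h2 := (Asymptotics.isBigO_refl (fun z => (z - w) ^ 4) (𝓝 w)).mul
      (hone (f := fun z => -A * (B + S / 6 * (p + p * A * (z - w) + B * (z - w) ^ 2)))
        (by fun_prop))
    refine ((h1.add h2).congr (fun z => ?_) (fun z => ?_))
    · have hq : iteratedDeriv 2 g w / 2 = p * A := by rw [hA]; field_simp
      simp only [Function.comp_apply, hq, ← hp, add_sub_cancel, hSB]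
      field_simp
      ring
    · simp
  have hquot := hnum.mul (hden.inv₀ hg' |>.isBigO_one ℂ)
  simp only [mul_one] at hquot
  obtain ⟨C, hC, hbound⟩ := hquot.exists_pos
  refine ⟨C, hC, ?_⟩
  filter_upwards [hbound.bound, hden.eventually_ne hg'] with z hz hz0
  rw [← norm_pow]
  refine (congrArg norm ?_).trans_le hz
  have hz1 : A / s * g z + (p - A * g w) / s = (p + A * (g z - g w)) / s := by ring
  rw [hz1]
  field_simp
  ring
end

section
/- Let w ∈ ℂ and let g : ℂ → ℂ be complex-analytic at w with deriv g w ≠ 0. Suppose a, b, c, d ∈ ℂ satisfy a·d − b·c ≠ 0 and c·g(w) + d ≠ 0, and suppose α ∈ ℂ is such that, as z → w, (a·g(z) + b)/(c·g(z) + d) = z + (α/6)·(z − w)^3 + O((z − w)^4). Then α = {g,w}, the Schwarzian derivative of g at w. (Uniqueness of the coefficient in Lemma 3.1 of the paper: the third-order coefficient in any Möbius normalization of g is uniquely determined to be the Schwarzian derivative.) -/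
open Complex Filter Topology

open Asymptotics

/-- An analytic function that is `O((z - w) ^ n)` at `w` vanishes to order at least `n` there. -/
lemma AnalyticAt.le_analyticOrderAt_of_isBigO {F : ℂ → ℂ} {w : ℂ} {n : ℕ}
    (hF : AnalyticAt ℂ F w) (h : F =O[𝓝 w] fun z => (z - w) ^ n) :
    (n : ℕ∞) ≤ analyticOrderAt F w := by
  by_contra! hlt
  obtain ⟨m, hm⟩ := ENat.ne_top_iff_exists.mp hlt.ne_top
  have hmn : m < n := by
    rw [← hm] at hlt
    exact_mod_cast hlt
  obtain ⟨u, hu, hu0, hFu⟩ := hF.analyticOrderAt_eq_natCast.mp hm.symm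
  have hne : ∀ᶠ z in 𝓝[≠] w, z - w ≠ 0 :=
    eventually_mem_nhdsWithin.mono fun z hz => sub_ne_zero.mpr hz
  have huO : u =O[𝓝[≠] w] fun z => (z - w) ^ (n - m) := by
    refine ((isBigO_refl (fun z => ((z - w) ^ m)⁻¹) _).mul
      (h.mono nhdsWithin_le_nhds)).congr' ?_ ?_
    · filter_upwards [hne, hFu.filter_mono nhdsWithin_le_nhds] with z hz hFz
      rw [hFz, smul_eq_mul, inv_mul_cancel_left₀ (pow_ne_zero m hz)]
    · filter_upwards [hne] with z hz
      rw [← Nat.add_sub_of_le hmn.le, pow_add, inv_mul_cancel_left₀ (pow_ne_zero m hz),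
        Nat.add_sub_cancel_left]
  have hlim : Tendsto (fun z => (z - w) ^ (n - m)) (𝓝[≠] w) (𝓝 0) := by
    have hcont : ContinuousAt (fun z => (z - w) ^ (n - m)) w := by fun_prop
    simpa [(Nat.sub_pos_of_lt hmn).ne'] using hcont.tendsto.mono_left nhdsWithin_le_nhds
  exact hu0 (tendsto_nhds_unique (hu.continuousAt.tendsto.mono_left nhdsWithin_le_nhds)
    (huO.trans_tendsto hlim))

lemma iteratedDeriv_sub_pow_self (w : ℂ) (k m : ℕ) :
    iteratedDeriv k (fun z => (z - w) ^ m) w = if k = m then (m.factorial : ℂ) else 0 := by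
  rw [iteratedDeriv_comp_sub_const k (fun z : ℂ => z ^ m) w]
  simp only [sub_self, iteratedDeriv_fun_pow_zero]
  split_ifs <;> simp_all

/-- The derivatives at `w` of the cubic `p + q (z - w) + r (z - w) ^ 3`. -/
lemma iteratedDeriv_cubic_self (w p q r : ℂ) (k : ℕ) :
    iteratedDeriv k (fun z => p + q * (z - w) ^ 1 + r * (z - w) ^ 3) w =
      (if k = 0 then p else 0) + q * (if k = 1 then 1 else 0) + r * (if k = 3 then 6 else 0) := by
  rw [iteratedDeriv_fun_add (by fun_prop) (by fun_prop),
    iteratedDeriv_fun_add (by fun_prop) (by fun_prop)]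
  simp only [iteratedDeriv_const_mul_field, iteratedDeriv_const, iteratedDeriv_sub_pow_self]
  norm_num [Nat.factorial]

/-- Uniqueness part of Lemma 3.1 (finite case): the third-order coefficient in any Möbius
normalization of `g` at `w` is the Schwarzian derivative `{g,w}`. -/
theorem mobius_normalization_coeff_unique (w : ℂ) (g : ℂ → ℂ)
    (hg : AnalyticAt ℂ g w) (hg' : deriv g w ≠ 0)
    (a b c d α : ℂ) (hdet : a * d - b * c ≠ 0) (hden : c * g w + d ≠ 0)
    (hexp : IsBigO4At w (fun z => (a * g z + b) / (c * g z + d))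
      (fun z => z + (α / 6) * (z - w) ^ 3)) :
    α = schwarzian g w := by
  obtain ⟨C, -, hC⟩ := hexp
  set A : ℂ → ℂ := fun z => (a - c * w) + -c * (z - w) ^ 1 + -(c * α / 6) * (z - w) ^ 3 with hA
  set B : ℂ → ℂ := fun z => (b - d * w) + -d * (z - w) ^ 1 + -(d * α / 6) * (z - w) ^ 3 with hB
  have hFan : AnalyticAt ℂ (fun z => A z * g z + B z) w := by fun_prop
  have hcont : ContinuousAt (fun z => c * g z + d) w := by
    have := hg.continuousAt
    fun_prop
  have hO : (fun z => A z * g z + B z) =O[𝓝 w] fun z => (z - w) ^ 4 := by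
    have hf : (fun z => (a * g z + b) / (c * g z + d) - (z + (α / 6) * (z - w) ^ 3))
        =O[𝓝 w] fun z => (z - w) ^ 4 :=
      IsBigO.of_bound C (hC.mono fun z hz => by simpa only [norm_pow] using hz)
    refine (hf.mul (hcont.tendsto.isBigO_one ℂ)).congr' ?_ (by simp)
    filter_upwards [hcont.eventually_ne hden] with z hz
    rw [sub_mul, div_mul_cancel₀ _ hz]
    simp only [hA, hB]
    ring
  have hzero := (natCast_le_analyticOrderAt_iff_iteratedDeriv_eq_zero hFan).mp
    (hFan.le_analyticOrderAt_of_isBigO hO)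
  have hLeib (k : ℕ) : iteratedDeriv k (fun z => A z * g z + B z) w =
      ∑ i ∈ Finset.range (k + 1),
        (k.choose i : ℂ) * iteratedDeriv i A w * iteratedDeriv (k - i) g w +
          iteratedDeriv k B w := by
    have hAc : ContDiffAt ℂ k A w := by fun_prop
    have hBc : ContDiffAt ℂ k B w := by fun_prop
    rw [iteratedDeriv_fun_add (hAc.mul hg.contDiffAt) hBc,
      iteratedDeriv_fun_mul hAc hg.contDiffAt]
  have h1 := hzero 1 (by norm_num)
  have h2 := hzero 2 (by norm_num)
  have h3 := hzero 3 (by norm_num)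
  rw [hLeib] at h1 h2 h3
  simp only [hA, hB, iteratedDeriv_cubic_self, Finset.sum_range_succ] at h1 h2 h3
  norm_num [iteratedDeriv_one, Nat.choose] at h1 h2 h3
  have hm : (a - c * w) * deriv g w = c * g w + d := by linear_combination h1
  have ha : a - c * w ≠ 0 := fun h => hden (by rw [← hm, h, zero_mul])
  have hs : (a - c * w) * iteratedDeriv 2 g w = 2 * c * deriv g w := by linear_combination h2
  have ht : (a - c * w) * iteratedDeriv 3 g w =
      3 * c * iteratedDeriv 2 g w + α * ((a - c * w) * deriv g w) := by
    linear_combination h3 - α * hm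
  rw [schwarzian]
  field_simp
  refine mul_left_cancel₀ ha ?_
  linear_combination 2 * deriv g w * (-ht) + 3 * iteratedDeriv 2 g w * hs
end

section
/- Let w ∈ ℂ, let F : ℂ → ℂ be complex-analytic at w with F(w) ≠ 0, and define g(z) = F(z)/(z − w) for z ≠ w. Then there exist a, b, c, d ∈ ℂ with a·d − b·c = 1 such that, as z → w (z ≠ w), (a·g(z) + b)/(c·g(z) + d) = z + (α/6)·(z − w)^3 + O((z − w)^4), where α = −3·F''(w)/F(w). (Lemma 3.1 of the paper, case g(w) = ∞: the Möbius normalization exists for a function with a simple pole, and its third-order coefficient, the Schwarzian derivative at the pole, equals −6C/A for Laurent coefficients A = F(w) and C = F''(w)/2.) -/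
open Complex Filter Topology

/-- `f z = φ z + O((z - w)^4)` as `z → w` with `z ≠ w`: there exist `C > 0` and a punctured
neighbourhood of `w` on which `‖f z - φ z‖ ≤ C * ‖z - w‖^4`. -/
def IsBigO4PunctAt (w : ℂ) (f φ : ℂ → ℂ) : Prop :=
  ∃ C > (0 : ℝ), ∀ᶠ z in 𝓝[≠] w, ‖f z - φ z‖ ≤ C * ‖z - w‖ ^ 4

/-- Second-order Taylor expansion of an analytic function, with cubic remainder. -/
theorem AnalyticAt.isBigO_sub_taylor_two {F : ℂ → ℂ} {w : ℂ} (hF : AnalyticAt ℂ F w) :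
    (fun z => F z - (F w + deriv F w * (z - w) + deriv (deriv F) w / 2 * (z - w) ^ 2))
      =O[𝓝 w] fun z => (z - w) ^ 3 := by
  have h := (hF.hasFPowerSeriesAt.isBigO_sub_partialSum_pow 3).comp_tendsto
    (tendsto_sub_nhds_zero_iff.2 (tendsto_id (x := 𝓝 w)))
  rw [← Asymptotics.isBigO_norm_right]
  simp only [norm_pow]
  refine h.congr_left fun z => ?_
  simp [FormalMultilinearSeries.partialSum, Finset.sum_range_succ, iteratedDeriv_succ,
    Nat.factorial]
  ring

/-- Lemma 3.1 of the paper, case `g w = ∞`: for `g z = F z / (z - w)` with a simple pole at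
`w`, there is a Möbius normalization `z + (α/6)(z-w)³ + O((z-w)⁴)` whose third-order
coefficient is `α = -3 F''(w)/F(w)` (that is, `-6C/A` with `A = F w`, `C = F'' w / 2`). -/
theorem mobius_normalization_exists_at_pole (w : ℂ) (F : ℂ → ℂ)
    (hF : AnalyticAt ℂ F w) (hFw : F w ≠ 0) (g : ℂ → ℂ)
    (hg : ∀ z : ℂ, z ≠ w → g z = F z / (z - w)) :
    ∃ a b c d : ℂ, a * d - b * c = 1 ∧
      IsBigO4PunctAt w (fun z => (a * g z + b) / (c * g z + d))
        (fun z => z + ((-3 * deriv (deriv F) w / F w) / 6) * (z - w) ^ 3) := by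
  obtain ⟨s, hs⟩ := IsAlgClosed.exists_pow_nat_eq (-1 / F w) (n := 2) two_pos
  have hs0 : s ≠ 0 := by
    rintro rfl
    field_simp at hs
    simp at hs
  refine ⟨s * w, s * (F w - w * deriv F w), s, -(s * deriv F w), ?_, ?_⟩
  · field_simp at hs
    linear_combination -hs
  have hR := hF.isBigO_sub_taylor_two
  set A := F w
  set B := deriv F w
  set C := deriv (deriv F) w / 2 with hC
  set R : ℂ → ℂ := fun z => F z - (A + B * (z - w) + C * (z - w) ^ 2)
  have hcont : ContinuousAt (fun z => F z - B * (z - w)) w := by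
    have := hF.continuousAt
    fun_prop
  have hD : ∀ᶠ z in 𝓝 w, F z - B * (z - w) ≠ 0 :=
    hcont.eventually_ne (by simpa using hFw)
  have hinv : (fun z => (A * (F z - B * (z - w)))⁻¹) =O[𝓝 w] fun _ => (1 : ℂ) := by
    refine ((hcont.const_mul A).inv₀ ?_).isBigO_one ℂ |>.congr_left fun _ => rfl
    simpa [A] using hFw
  have hbdd (f : ℂ → ℂ) (hf : Continuous f) : f =O[𝓝 w] fun _ => (1 : ℂ) :=
    hf.continuousAt.isBigO_one ℂ
  have hmain : (fun z => ((C ^ 2 * (z - w)) * (z - w) ^ 4 +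
      (C * (z - w) ^ 2 - A) * ((z - w) * R z)) * (A * (F z - B * (z - w)))⁻¹)
      =O[𝓝 w] fun z => (z - w) ^ 4 := by
    have h₁ := (hbdd (fun z => C ^ 2 * (z - w)) (by fun_prop)).mul
      (Asymptotics.isBigO_refl (fun z => (z - w) ^ 4) (𝓝 w))
    have h₂ := (hbdd (fun z => C * (z - w) ^ 2 - A) (by fun_prop)).mul
      ((Asymptotics.isBigO_refl (fun z => z - w) (𝓝 w)).mul hR)
    refine ((h₁.add (h₂.congr_right fun z => by ring)).mul hinv).congr_right fun z => by ring
  obtain ⟨K, hK, hbound⟩ := hmain.exists_pos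
  refine ⟨K, hK, ?_⟩
  filter_upwards [hbound.bound.filter_mono nhdsWithin_le_nhds,
    hD.filter_mono nhdsWithin_le_nhds, self_mem_nhdsWithin] with z hz hDz hzw
  rw [← norm_pow]
  convert hz using 2
  have hh : z - w ≠ 0 := sub_ne_zero.2 hzw
  have hC' : deriv (deriv F) w = 2 * C := by rw [hC]; ring
  simp only [R]
  rw [hg z hzw, hC']
  obtain ⟨h, rfl⟩ : ∃ h, z = w + h := ⟨z - w, by ring⟩
  rw [add_sub_cancel_left] at hDz hh ⊢
  generalize F (w + h) = f at hDz ⊢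
  obtain ⟨D, rfl⟩ : ∃ D, f = D + B * h := ⟨f - B * h, by ring⟩
  rw [add_sub_cancel_right] at hDz ⊢
  have hden : s * ((D + B * h) / h) + -(s * B) = s * D / h := by
    field_simp
    ring
  rw [hden]
  field_simp
  ring
end

section
/- Let w ∈ ℂ, let F : ℂ → ℂ be complex-analytic at w with F(w) ≠ 0, and define g(z) = F(z)/(z − w) for z ≠ w. Then the limit as z → w (z ≠ w) of 2·g'(z)/((z − w)·g(z)) + g''(z)/g(z) exists and equals F''(w)/F(w); consequently −3·lim_{z→w}(2·g'(z)/((z − w)·g(z)) + g''(z)/g(z)) = −3·F''(w)/F(w). (Consistency of the paper's definition (6.5) of the Schwarzian derivative at a pole: the limit formula reproduces the coefficient −6C/A with A = F(w), C = F''(w)/2.) -/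
open Complex Filter Topology

/-- The second derivative of `y ↦ (y - w) * g y`. -/
theorem AnalyticAt.deriv_deriv_sub_mul {g : ℂ → ℂ} {z : ℂ} (w : ℂ) (hg : AnalyticAt ℂ g z) :
    deriv (deriv fun y => (y - w) * g y) z = 2 * deriv g z + (z - w) * deriv (deriv g) z := by
  have hderiv : deriv (fun y => (y - w) * g y) =ᶠ[𝓝 z] fun y => g y + (y - w) * deriv g y := by
    filter_upwards [hg.eventually_analyticAt] with y hy
    refine (((hasDerivAt_id y).sub_const w).mul hy.differentiableAt.hasDerivAt).deriv.trans ?_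
    simp only [id, one_mul]
  have hderiv₂ := hg.differentiableAt.hasDerivAt.add
    (((hasDerivAt_id z).sub_const w).mul hg.deriv.differentiableAt.hasDerivAt)
  rw [hderiv.deriv_eq]
  refine hderiv₂.deriv.trans ?_
  simp only [id]
  ring

/-- Consistency of the paper's definition (6.5) of the Schwarzian derivative at a pole:
for `g z = F z / (z - w)` with a simple pole at `w`, the limit as `z → w`, `z ≠ w`, of
`2 g'(z)/((z-w) g(z)) + g''(z)/g(z)` exists and equals `F''(w)/F(w)`; consequently
`-3` times this limit equals `-3 F''(w)/F(w)`. -/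
theorem schwarzian_at_pole_limit (w : ℂ) (F : ℂ → ℂ)
    (hF : AnalyticAt ℂ F w) (hFw : F w ≠ 0) (g : ℂ → ℂ)
    (hg : ∀ z : ℂ, z ≠ w → g z = F z / (z - w)) :
    Tendsto (fun z => 2 * deriv g z / ((z - w) * g z) + deriv (deriv g) z / g z)
      (𝓝[≠] w) (𝓝 (deriv (deriv F) w / F w)) ∧
    Tendsto (fun z => -3 * (2 * deriv g z / ((z - w) * g z) + deriv (deriv g) z / g z))
      (𝓝[≠] w) (𝓝 (-3 * (deriv (deriv F) w / F w))) := by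
  have hlim : Tendsto (fun z => deriv (deriv F) z / F z) (𝓝[≠] w)
      (𝓝 (deriv (deriv F) w / F w)) :=
    (hF.deriv.deriv.continuousAt.div hF.continuousAt hFw).tendsto.mono_left nhdsWithin_le_nhds
  have heq : (fun z => deriv (deriv F) z / F z) =ᶠ[𝓝[≠] w]
      fun z => 2 * deriv g z / ((z - w) * g z) + deriv (deriv g) z / g z := by
    filter_upwards [self_mem_nhdsWithin, nhdsWithin_le_nhds hF.eventually_analyticAt,
      nhdsWithin_le_nhds (hF.continuousAt.eventually_ne hFw)] with z hzw hFz hFz₀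
    have hsub : z - w ≠ 0 := sub_ne_zero.mpr hzw
    have hne : ∀ᶠ y in 𝓝 z, y ≠ w := eventually_ne_nhds hzw
    have hgz : AnalyticAt ℂ g z :=
      (hFz.div (analyticAt_id.sub analyticAt_const) hsub).congr
        (hne.mono fun y hy => (hg y hy).symm)
    have hFg : F =ᶠ[𝓝 z] fun y => (y - w) * g y :=
      hne.mono fun y hy => by
        simp only [hg y hy]
        rw [mul_div_cancel₀ _ (sub_ne_zero.mpr hy)]
    have hgz₀ : g z ≠ 0 := by
      rw [hg z hzw]
      exact div_ne_zero hFz₀ hsub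
    rw [hFg.deriv.deriv_eq, hgz.deriv_deriv_sub_mul w, hFg.eq_of_nhds]
    field_simp
  exact ⟨hlim.congr' heq, (hlim.congr' heq).const_mul (-3)⟩
end
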